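/- Let V be a finite set and E' ⊆ V × V a set of directed edges such that every vertex has at most one outgoing E'-edge and at most one incoming E'-edge. Then the number of edges of E' equals the number of vertices incident to some E'-edge minus the number of vertices that have an outgoing E'-edge but no incoming E'-edge. -/

import Mathlib

/-- In a directed graph where every vertex has at most one outgoing
edge and at most one incoming edge, the number of edges equals the number of vertices
incident to some edge minus the number of vertices having an outgoing edge but no
incoming edge. -/
theorem card_edges_eq_incident_sub_path_starts
    {V : Type*} [Fintype V] [DecidableEq V] (E' : Finset (V × V))
    (hout : ∀ v w w' : V, (v, w) ∈ E' → (v, w') ∈ E' → w = w')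
    (hin : ∀ v w w' : V, (w, v) ∈ E' → (w', v) ∈ E' → w = w') :
    E'.card =
      (Finset.univ.filter fun v : V => ∃ w, (v, w) ∈ E' ∨ (w, v) ∈ E').card
        - (Finset.univ.filter fun v : V =>
            (∃ w, (v, w) ∈ E') ∧ ∀ w, (w, v) ∉ E').card := by
  have heads : E'.card = (E'.image Prod.snd).card := by
    refine (Finset.card_image_of_injOn ?_).symm
    rintro ⟨a, b⟩ hab ⟨c, d⟩ hcd (rfl : b = d)
    rw [hin b a c hab hcd]
  rw [heads, ← Finset.card_sdiff_of_subset]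
  · congr 1
    ext v
    simp only [Finset.mem_image, Finset.mem_sdiff, Finset.mem_filter, Finset.mem_univ,
      true_and, Prod.exists, exists_eq_right]
    grind
  · intro v
    simp only [Finset.mem_filter, Finset.mem_univ, true_and]
    rintro ⟨⟨w, hw⟩, -⟩
    exact ⟨w, Or.inl hw⟩
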